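/- Let a > 0 be a real number and let Γ : ℝ → ℝ be Γ(x) = −√a·tanh(√a·x). A smooth function f : ℝ² → ℝ satisfies the Kähler equations for Γ (that is, ∂²f/∂x² − ∂²f/∂y² = 2Γ(x)·∂f/∂x and ∂²f/∂x∂y = Γ(x)·∂f/∂y everywhere) if and only if there exist real numbers α₁, α₂, α₃, α₄ such that f(x,y) = α₁ + α₂·tanh(√a·x) + α₃·cos(√a·y)/cosh(√a·x) + α₄·sin(√a·y)/cosh(√a·x) for all (x,y) ∈ ℝ². Hence the space of such solutions is exactly the 4-dimensional span of 1, tanh(√a x), cos(√a y)/cosh(√a x), sin(√a y)/cosh(√a x). -/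

import Mathlib

/-- Partial derivative in the first variable. -/
noncomputable def pdx (f : ℝ → ℝ → ℝ) (x y : ℝ) : ℝ := deriv (fun t => f t y) x

/-- Partial derivative in the second variable. -/
noncomputable def pdy (f : ℝ → ℝ → ℝ) (x y : ℝ) : ℝ := deriv (fun t => f x t) y

/-- The Kähler equations for a Christoffel symbol `Γ` on `I × ℝ`. -/
def KahlerEqs (I : Set ℝ) (Γ : ℝ → ℝ) (f : ℝ → ℝ → ℝ) : Prop :=
  ∀ x ∈ I, ∀ y : ℝ,
    pdx (pdx f) x y - pdy (pdy f) x y = 2 * Γ x * pdx f x y ∧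
    pdx (pdy f) x y = Γ x * pdy f x y

theorem hasDerivAt_fst_fderiv {f : ℝ → ℝ → ℝ} (hf : Differentiable ℝ (fun p : ℝ × ℝ => f p.1 p.2))
    (x y : ℝ) : HasDerivAt (fun t => f t y) (fderiv ℝ (fun p : ℝ × ℝ => f p.1 p.2) (x, y) (1, 0)) x :=
  HasFDerivAt.comp_hasDerivAt (f := fun t : ℝ => (t, y)) x (hf (x, y)).hasFDerivAt
    ((hasDerivAt_id x).prodMk (hasDerivAt_const x y))

theorem hasDerivAt_snd_fderiv {f : ℝ → ℝ → ℝ} (hf : Differentiable ℝ (fun p : ℝ × ℝ => f p.1 p.2))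
    (x y : ℝ) : HasDerivAt (fun t => f x t) (fderiv ℝ (fun p : ℝ × ℝ => f p.1 p.2) (x, y) (0, 1)) y :=
  HasFDerivAt.comp_hasDerivAt (f := fun t : ℝ => (x, t)) y (hf (x, y)).hasFDerivAt
    ((hasDerivAt_const y x).prodMk (hasDerivAt_id y))

theorem hasDerivAt_pdx {f : ℝ → ℝ → ℝ} (hf : Differentiable ℝ (fun p : ℝ × ℝ => f p.1 p.2))
    (x y : ℝ) : HasDerivAt (fun t => f t y) (pdx f x y) x :=
  (hasDerivAt_fst_fderiv hf x y).differentiableAt.hasDerivAt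

theorem hasDerivAt_pdy {f : ℝ → ℝ → ℝ} (hf : Differentiable ℝ (fun p : ℝ × ℝ => f p.1 p.2))
    (x y : ℝ) : HasDerivAt (fun t => f x t) (pdy f x y) y :=
  (hasDerivAt_snd_fderiv hf x y).differentiableAt.hasDerivAt

theorem differentiable_pdx {f : ℝ → ℝ → ℝ} (hf : ContDiff ℝ 2 (fun p : ℝ × ℝ => f p.1 p.2)) :
    Differentiable ℝ (fun p : ℝ × ℝ => pdx f p.1 p.2) := by
  have h : (fun p : ℝ × ℝ => pdx f p.1 p.2)
      = fun p => fderiv ℝ (fun p : ℝ × ℝ => f p.1 p.2) p (1, 0) :=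
    funext fun p => (hasDerivAt_fst_fderiv (hf.differentiable (by norm_num)) p.1 p.2).deriv
  rw [h]
  exact ((hf.fderiv_right (m := 1) (by norm_num)).differentiable (by norm_num)).clm_apply
    (differentiable_const _)

theorem differentiable_pdy {f : ℝ → ℝ → ℝ} (hf : ContDiff ℝ 2 (fun p : ℝ × ℝ => f p.1 p.2)) :
    Differentiable ℝ (fun p : ℝ × ℝ => pdy f p.1 p.2) := by
  have h : (fun p : ℝ × ℝ => pdy f p.1 p.2)
      = fun p => fderiv ℝ (fun p : ℝ × ℝ => f p.1 p.2) p (0, 1) :=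
    funext fun p => (hasDerivAt_snd_fderiv (hf.differentiable (by norm_num)) p.1 p.2).deriv
  rw [h]
  exact ((hf.fderiv_right (m := 1) (by norm_num)).differentiable (by norm_num)).clm_apply
    (differentiable_const _)

theorem eq_of_hasDerivAt_zero {g : ℝ → ℝ} (h : ∀ x, HasDerivAt g 0 x) (x y : ℝ) : g x = g y :=
  is_const_of_deriv_eq_zero (fun x => (h x).differentiableAt) (fun x => (h x).deriv) x y

theorem hasDerivAt_cosh_mul (s x : ℝ) :
    HasDerivAt (fun t => Real.cosh (s * t)) (s * Real.sinh (s * x)) x := by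
  simpa [mul_comm] using ((hasDerivAt_id x).const_mul s).cosh

theorem hasDerivAt_sinh_mul (s x : ℝ) :
    HasDerivAt (fun t => Real.sinh (s * t)) (s * Real.cosh (s * x)) x := by
  simpa [mul_comm] using ((hasDerivAt_id x).const_mul s).sinh

theorem hasDerivAt_cos_mul (s x : ℝ) :
    HasDerivAt (fun t => Real.cos (s * t)) (-(s * Real.sin (s * x))) x := by
  simpa [mul_comm] using ((hasDerivAt_id x).const_mul s).cos

theorem hasDerivAt_sin_mul (s x : ℝ) :
    HasDerivAt (fun t => Real.sin (s * t)) (s * Real.cos (s * x)) x := by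
  simpa [mul_comm] using ((hasDerivAt_id x).const_mul s).sin

/-- The solutions of the harmonic oscillator equation `u'' = -s² u`. -/
theorem harmonic_oscillator {s : ℝ} (hs : s ≠ 0) {u v : ℝ → ℝ}
    (hu : ∀ y, HasDerivAt u (v y) y) (hv : ∀ y, HasDerivAt v (-s ^ 2 * u y) y) (y : ℝ) :
    u y = u 0 * Real.cos (s * y) + v 0 / s * Real.sin (s * y) := by
  have h₁ := eq_of_hasDerivAt_zero (g := fun y =>
    s * u y * Real.cos (s * y) - v y * Real.sin (s * y)) (fun y => by
      refine ((((hu y).const_mul s).mul (hasDerivAt_cos_mul s y)).sub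
        ((hv y).mul (hasDerivAt_sin_mul s y))).congr_deriv ?_
      ring) y 0
  have h₂ := eq_of_hasDerivAt_zero (g := fun y =>
    s * u y * Real.sin (s * y) + v y * Real.cos (s * y)) (fun y => by
      refine ((((hu y).const_mul s).mul (hasDerivAt_sin_mul s y)).add
        ((hv y).mul (hasDerivAt_cos_mul s y))).congr_deriv ?_
      ring) y 0
  simp only [mul_zero, Real.cos_zero, Real.sin_zero] at h₁ h₂
  field_simp
  linear_combination Real.cos (s * y) * h₁ + Real.sin (s * y) * h₂
    - s * u y * Real.sin_sq_add_cos_sq (s * y)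

/-- The solutions of `R'' + 2 s tanh(s x) R' = k / cosh(s x)`. -/
theorem ode_tanh {s k : ℝ} (hs : s ≠ 0) {R R' R'' : ℝ → ℝ}
    (h₁ : ∀ x, HasDerivAt R (R' x) x) (h₂ : ∀ x, HasDerivAt R' (R'' x) x)
    (h : ∀ x, R'' x + 2 * (s * Real.tanh (s * x)) * R' x = k / Real.cosh (s * x)) (x : ℝ) :
    R x = R 0 + k / s ^ 2 + R' 0 / s * Real.tanh (s * x) - k / s ^ 2 / Real.cosh (s * x) := by
  have hc : ∀ x, Real.cosh (s * x) ≠ 0 := fun x => (Real.cosh_pos _).ne'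
  have hR' : ∀ x, R' x = (R' 0 + k / s * Real.sinh (s * x)) / Real.cosh (s * x) ^ 2 := by
    intro x
    have key := eq_of_hasDerivAt_zero (g := fun x =>
      R' x * Real.cosh (s * x) ^ 2 - k / s * Real.sinh (s * x)) (fun x => by
        refine (((h₂ x).mul ((hasDerivAt_cosh_mul s x).pow 2)).sub
          ((hasDerivAt_sinh_mul s x).const_mul (k / s))).congr_deriv ?_
        have hx := h x
        have := hc x
        rw [Real.tanh_eq_sinh_div_cosh] at hx
        simp only [Pi.pow_apply]
        field_simp at hx ⊢
        push_cast
        linear_combination Real.cosh (s * x) * hx) x 0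
    simp only [mul_zero, Real.cosh_zero, Real.sinh_zero] at key
    rw [eq_div_iff (pow_ne_zero 2 (hc x))]
    linear_combination key
  have key := eq_of_hasDerivAt_zero (g := fun x =>
    R x - R' 0 / s * (Real.sinh (s * x) / Real.cosh (s * x))
      + k / s ^ 2 * (Real.cosh (s * x))⁻¹) (fun x => by
      refine (((h₁ x).sub (((hasDerivAt_sinh_mul s x).div (hasDerivAt_cosh_mul s x)
        (hc x)).const_mul (R' 0 / s))).add
        (((hasDerivAt_cosh_mul s x).inv (hc x)).const_mul (k / s ^ 2))).congr_deriv ?_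
      rw [hR' x]
      have := hc x
      field_simp
      linear_combination -(s * R' 0) * Real.cosh_sq (s * x)) x 0
  simp only [mul_zero, Real.cosh_zero, Real.sinh_zero] at key
  rw [Real.tanh_eq_sinh_div_cosh, div_eq_mul_inv (k / s ^ 2)]
  linear_combination key

theorem kahlerEqs_tanh_solution (s α₁ α₂ α₃ α₄ : ℝ) :
    KahlerEqs Set.univ (fun x => -s * Real.tanh (s * x)) (fun x y =>
      α₁ + α₂ * Real.tanh (s * x) + α₃ * Real.cos (s * y) / Real.cosh (s * x)
        + α₄ * Real.sin (s * y) / Real.cosh (s * x)) := by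
  have hc : ∀ x, Real.cosh (s * x) ≠ 0 := fun x => (Real.cosh_pos _).ne'
  set f : ℝ → ℝ → ℝ := fun x y =>
      α₁ + α₂ * Real.tanh (s * x) + α₃ * Real.cos (s * y) / Real.cosh (s * x)
        + α₄ * Real.sin (s * y) / Real.cosh (s * x) with hf
  have hx : pdx f = fun x y => s * (α₂ - Real.sinh (s * x) *
      (α₃ * Real.cos (s * y) + α₄ * Real.sin (s * y))) / Real.cosh (s * x) ^ 2 := by
    funext x y
    refine HasDerivAt.deriv ?_
    simp only [hf, Real.tanh_eq_sinh_div_cosh]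
    refine ((((((hasDerivAt_sinh_mul s x).div (hasDerivAt_cosh_mul s x) (hc x)).const_mul
      α₂).const_add α₁).add ((hasDerivAt_const x (α₃ * Real.cos (s * y))).div
        (hasDerivAt_cosh_mul s x) (hc x))).add
      ((hasDerivAt_const x (α₄ * Real.sin (s * y))).div (hasDerivAt_cosh_mul s x) (hc x))).congr_deriv ?_
    have := hc x
    field_simp
    linear_combination α₂ * s * Real.cosh_sq (s * x)
  have hy : pdy f = fun x y => s *
      (α₄ * Real.cos (s * y) - α₃ * Real.sin (s * y)) / Real.cosh (s * x) := by
    funext x y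
    refine HasDerivAt.deriv ?_
    refine (((((hasDerivAt_cos_mul s y).const_mul α₃).div_const (Real.cosh (s * x))).const_add
      (α₁ + α₂ * Real.tanh (s * x))).add
      (((hasDerivAt_sin_mul s y).const_mul α₄).div_const (Real.cosh (s * x)))).congr_deriv ?_
    ring
  intro x _ y
  have hxx := (congrArg (pdx · x y) hx).trans (((((hasDerivAt_sinh_mul s x).mul_const
    (α₃ * Real.cos (s * y) + α₄ * Real.sin (s * y))).const_sub α₂).const_mul s).div
      ((hasDerivAt_cosh_mul s x).pow 2) (pow_ne_zero 2 (hc x))).deriv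
  have hyx := (congrArg (pdx · x y) hy).trans ((hasDerivAt_const x
    (s * (α₄ * Real.cos (s * y) - α₃ * Real.sin (s * y)))).div
      (hasDerivAt_cosh_mul s x) (hc x)).deriv
  have hyy := (congrArg (pdy · x y) hy).trans (((((hasDerivAt_cos_mul s y).const_mul α₄).sub
    ((hasDerivAt_sin_mul s y).const_mul α₃)).const_mul s).div_const (Real.cosh (s * x))).deriv
  rw [hxx, hyx, hyy, hx, hy]
  have := hc x
  simp only [Real.tanh_eq_sinh_div_cosh, Pi.pow_apply]
  constructor
  · field_simp
    push_cast
    ring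
  · field_simp
    ring

theorem KahlerEqs.exists_tanh_solution {s : ℝ} (hs : s ≠ 0) {f : ℝ → ℝ → ℝ}
    (hf : ContDiff ℝ 2 (fun p : ℝ × ℝ => f p.1 p.2))
    (h : KahlerEqs Set.univ (fun x => -s * Real.tanh (s * x)) f) :
    ∃ α₁ α₂ α₃ α₄ : ℝ, ∀ x y : ℝ,
      f x y = α₁ + α₂ * Real.tanh (s * x) + α₃ * Real.cos (s * y) / Real.cosh (s * x)
        + α₄ * Real.sin (s * y) / Real.cosh (s * x) := by
  have hc : ∀ x, Real.cosh (s * x) ≠ 0 := fun x => (Real.cosh_pos _).ne'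
  have hf₁ : Differentiable ℝ (fun p : ℝ × ℝ => f p.1 p.2) := hf.differentiable (by norm_num)
  have heq : ∀ x y, pdx (pdx f) x y - pdy (pdy f) x y = 2 * (-s * Real.tanh (s * x)) * pdx f x y ∧
      pdx (pdy f) x y = -s * Real.tanh (s * x) * pdy f x y := fun x y => h x trivial y
  have dx := hasDerivAt_pdx hf₁
  have dy := hasDerivAt_pdy hf₁
  have dxx := hasDerivAt_pdx (differentiable_pdx hf)
  have dyx := hasDerivAt_pdx (differentiable_pdy hf)
  have dyy := hasDerivAt_pdy (differentiable_pdy hf)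
  have hfy : ∀ x y, pdy f x y = pdy f 0 y / Real.cosh (s * x) := by
    intro x y
    have key := eq_of_hasDerivAt_zero (g := fun x => pdy f x y * Real.cosh (s * x)) (fun x => by
      refine ((dyx x y).mul (hasDerivAt_cosh_mul s x)).congr_deriv ?_
      have := hc x
      rw [(heq x y).2, Real.tanh_eq_sinh_div_cosh]
      field_simp
      ring) x 0
    rw [eq_div_iff (hc x)]
    simpa using key
  have hfsep : ∀ x y, f x y = f x 0 + (f 0 y - f 0 0) / Real.cosh (s * x) := by
    intro x y
    have key := eq_of_hasDerivAt_zero (g := fun y => f x y - f 0 y / Real.cosh (s * x))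
      (fun y => by
        refine ((dy x y).sub ((dy 0 y).div_const (Real.cosh (s * x)))).congr_deriv ?_
        rw [hfy x y, sub_self]) y 0
    linear_combination key
  set k := pdy (pdy f) 0 0
  have hR := ode_tanh (k := k) hs (fun x => dx x 0) (fun x => dxx x 0) (fun x => by
    have h₁ := (heq x 0).1
    have h₂ : pdy (pdy f) x 0 = k / Real.cosh (s * x) := by
      refine HasDerivAt.deriv ?_
      simp only [hfy x]
      exact (dyy 0 0).div_const _
    linear_combination h₁ + h₂)
  have hfx : ∀ x y, pdx f x y = pdx f x 0
      - (f 0 y - f 0 0) * (s * Real.sinh (s * x) / Real.cosh (s * x) ^ 2) := by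
    intro x y
    refine HasDerivAt.deriv ?_
    rw [funext fun t => hfsep t y]
    refine ((dx x 0).add ((hasDerivAt_const x (f 0 y - f 0 0)).div
      (hasDerivAt_cosh_mul s x) (hc x))).congr_deriv ?_
    ring
  have hfxx : ∀ y, pdx (pdx f) 0 y = pdx (pdx f) 0 0 - (f 0 y - f 0 0) * s ^ 2 := by
    intro y
    refine HasDerivAt.deriv ?_
    rw [funext fun t => hfx t y]
    refine ((dxx 0 0).sub ((((hasDerivAt_sinh_mul s 0).const_mul s).div
      ((hasDerivAt_cosh_mul s 0).pow 2) (pow_ne_zero 2 (hc 0))).const_mul (f 0 y - f 0 0))).congr_deriv ?_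
    simp
    exact Or.inl (by ring)
  have hkey : ∀ y, pdy (pdy f) 0 y = k - s ^ 2 * (f 0 y - f 0 0) := by
    intro y
    have h₁ := (heq 0 y).1
    have h₂ := (heq 0 0).1
    simp only [mul_zero, Real.tanh_zero, zero_mul] at h₁ h₂
    linear_combination hfxx y - h₁ + h₂
  have hQ := harmonic_oscillator hs (u := fun y => f 0 y - f 0 0 - k / s ^ 2)
    (v := fun y => pdy f 0 y) (fun y => ((dy 0 y).sub_const _).sub_const _) (fun y => by
      refine (dyy 0 y).congr_deriv ?_
      rw [hkey y]
      field_simp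
      ring)
  refine ⟨f 0 0 + k / s ^ 2, pdx f 0 0 / s, -(k / s ^ 2), pdy f 0 0 / s, fun x y => ?_⟩
  have hQy := hQ y
  rw [hfsep x y, hR x]
  linear_combination hQy / Real.cosh (s * x)

theorem stmt19 (a : ℝ) (ha : 0 < a) (f : ℝ → ℝ → ℝ)
    (hf : ContDiff ℝ (⊤ : ℕ∞) (fun p : ℝ × ℝ => f p.1 p.2)) :
    KahlerEqs Set.univ (fun x => -Real.sqrt a * Real.tanh (Real.sqrt a * x)) f ↔
      ∃ α₁ α₂ α₃ α₄ : ℝ, ∀ x y : ℝ,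
        f x y = α₁ + α₂ * Real.tanh (Real.sqrt a * x)
          + α₃ * Real.cos (Real.sqrt a * y) / Real.cosh (Real.sqrt a * x)
          + α₄ * Real.sin (Real.sqrt a * y) / Real.cosh (Real.sqrt a * x) := by
  constructor
  · exact KahlerEqs.exists_tanh_solution (Real.sqrt_pos.2 ha).ne'
      (hf.of_le (WithTop.coe_le_coe.2 le_top))
  · rintro ⟨α₁, α₂, α₃, α₄, h⟩
    obtain rfl : f = _ := funext fun x => funext fun y => h x y
    exact kahlerEqs_tanh_solution _ α₁ α₂ α₃ α₄
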